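/- arXiv:1201.6294 — 3 statements merged into one kernel-verified Lean document; each statement's English description precedes it below -/
import Mathlib

section
/- For linearly independent vectors u and v in V, with φ and ψ the angles between u and v with respect to ⟨·,·⟩₁ and ⟨·,·⟩₂ respectively, equality tan(ψ/2) = (m/M)·tan(φ/2) holds if and only if (u,−v) ∈ E. -/
/-- The tangent of a half angle is the nonnegative root of `(1 - cos x) / (1 + cos x)`. -/
theorem tan_half_sq_mul_one_add_cos {x : ℝ} (h : 0 < 1 + Real.cos x) :
    Real.tan (x / 2) ^ 2 * (1 + Real.cos x) = 1 - Real.cos x := by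
  have h2 : Real.cos x = 2 * Real.cos (x / 2) ^ 2 - 1 := by
    rw [← Real.cos_two_mul]
    ring_nf
  have hc : Real.cos (x / 2) ≠ 0 := by
    intro h0
    rw [h2, h0] at h
    norm_num at h
  have h3 := Real.sin_sq_add_cos_sq (x / 2)
  rw [Real.tan_eq_sin_div_cos, h2]
  field_simp
  linear_combination 2 * Real.cos (x / 2) ^ 2 * h3

theorem tan_half_nonneg {x : ℝ} (hx : x ∈ Set.Icc 0 Real.pi) : 0 ≤ Real.tan (x / 2) :=
  Real.tan_nonneg_of_nonneg_of_le_pi_div_two (by linarith [hx.1]) (by linarith [hx.2])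

/-- For angles in `[0, π]` different from `π`, the equality
`tan (y / 2) = r * tan (x / 2)` can be checked after squaring. -/
theorem tan_half_eq_mul_tan_half_iff {x y r : ℝ} (hr : 0 ≤ r) (hx : x ∈ Set.Icc 0 Real.pi)
    (hy : y ∈ Set.Icc 0 Real.pi) (hcx : 0 < 1 + Real.cos x) (hcy : 0 < 1 + Real.cos y) :
    Real.tan (y / 2) = r * Real.tan (x / 2) ↔
      (1 - Real.cos y) * (1 + Real.cos x) = r ^ 2 * (1 - Real.cos x) * (1 + Real.cos y) := by
  rw [← pow_left_inj₀ (tan_half_nonneg hy) (mul_nonneg hr (tan_half_nonneg hx)) two_ne_zero,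
    ← tan_half_sq_mul_one_add_cos hcx, ← tan_half_sq_mul_one_add_cos hcy]
  have hne : (1 + Real.cos x) * (1 + Real.cos y) ≠ 0 := (mul_pos hcx hcy).ne'
  rw [← mul_left_inj' hne]
  ring_nf

/-- With `A`, `B` the lengths of two vectors `a`, `b` and `c` their inner product, `hsum` bounds the
squared length of `a + b`, and `hperp` bounds from below the squared length of a multiple of the
component of `a - b` orthogonal to `a + b`. -/
theorem half_angle_ratio_eq_iff {A B c p q m M : ℝ} (hA : 0 < A) (hB : 0 < B)
    (hp : 0 < p) (hq : 0 < q) (hm : 0 < m) (hM : 0 < M) (hP : 0 < A ^ 2 + B ^ 2 + 2 * c)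
    (hc : 0 < A * B + c)
    (hsum : A ^ 2 + B ^ 2 + 2 * c ≤ M ^ 2 * p)
    (hperp : m ^ 2 * ((A ^ 2 + B ^ 2 + 2 * c) ^ 2 * q + (A ^ 2 - B ^ 2) ^ 2 * p) ≤
      4 * (A * B - c) * (A * B + c) * (A ^ 2 + B ^ 2 + 2 * c)) :
    (A * B - c) * (M ^ 2 * p) = m ^ 2 * q * (A * B + c) ↔
      A ^ 2 + B ^ 2 - 2 * c = m ^ 2 * q ∧ A ^ 2 + B ^ 2 + 2 * c = M ^ 2 * p := by
  obtain ⟨P, hPdef⟩ : ∃ P, P = A ^ 2 + B ^ 2 + 2 * c := ⟨_, rfl⟩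
  rw [← hPdef] at hP hsum hperp ⊢
  have hAB : A ^ 2 - B ^ 2 = 0 → A = B := fun h ↦ by
    rwa [sub_eq_zero, pow_left_inj₀ hA.le hB.le two_ne_zero] at h
  constructor
  · intro h
    have h1 : M ^ 2 * p * (m ^ 2 * (P ^ 2 * q + (A ^ 2 - B ^ 2) ^ 2 * p)) ≤
        m ^ 2 * q * P * (2 * (A * B + c)) ^ 2 := by
      calc _ ≤ M ^ 2 * p * (4 * (A * B - c) * (A * B + c) * P) := by gcongr
        _ = 4 * ((A * B - c) * (M ^ 2 * p)) * (A * B + c) * P := by ring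
        _ = _ := by rw [h]; ring
    have h2 : (2 * (A * B + c)) ^ 2 ≤ P ^ 2 := by
      gcongr
      nlinarith [sq_nonneg (A - B)]
    have h3 : m ^ 2 * q * P * (2 * (A * B + c)) ^ 2 ≤ m ^ 2 * q * P * P ^ 2 := by gcongr
    have h4 : m ^ 2 * q * P ^ 2 * P ≤ m ^ 2 * q * P ^ 2 * (M ^ 2 * p) := by gcongr
    have h5 : M ^ 2 * p * m ^ 2 * p * (A ^ 2 - B ^ 2) ^ 2 ≤ 0 := by linarith
    have h6 : 0 < M ^ 2 * p * m ^ 2 * p := by positivity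
    have h7 : A = B := hAB (pow_eq_zero_iff two_ne_zero |>.mp
      (le_antisymm (nonpos_of_mul_nonpos_right h5 h6) (sq_nonneg _)))
    subst h7
    have h8 : 2 * (A * A + c) = P := by rw [hPdef]; ring
    rw [h8] at h1
    have h9 : m ^ 2 * q * P ^ 2 * (M ^ 2 * p) ≤ m ^ 2 * q * P ^ 2 * P := by linarith
    have h10 : P = M ^ 2 * p := le_antisymm hsum (le_of_mul_le_mul_left h9 (by positivity))
    refine ⟨?_, h10⟩
    rw [← h10] at h
    apply mul_right_cancel₀ hP.ne'
    linear_combination 2 * h + m ^ 2 * q * h8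
  · rintro ⟨hQ, hP'⟩
    have h1 : 4 * (A * B - c) * (A * B + c) =
        (A ^ 2 + B ^ 2 - 2 * c) * P - (A ^ 2 - B ^ 2) ^ 2 := by rw [hPdef]; ring
    rw [h1, hQ] at hperp
    have h5 : (m ^ 2 * p + P) * (A ^ 2 - B ^ 2) ^ 2 ≤ 0 := by linarith
    have h7 : A = B := hAB (pow_eq_zero_iff two_ne_zero |>.mp
      (le_antisymm (nonpos_of_mul_nonpos_right h5 (by positivity)) (sq_nonneg _)))
    subst h7
    rw [← hP', ← hQ, hPdef]
    ring

theorem sqrt_eq_mul_sqrt_iff {x y r : ℝ} (hx : 0 ≤ x) (hy : 0 ≤ y) (hr : 0 ≤ r) :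
    Real.sqrt x = r * Real.sqrt y ↔ x = r ^ 2 * y := by
  rw [← pow_left_inj₀ (Real.sqrt_nonneg x) (mul_nonneg hr (Real.sqrt_nonneg y)) two_ne_zero,
    mul_pow, Real.sq_sqrt hx, Real.sq_sqrt hy]


/-- Theorem 2.4, equality case for the left-hand inequality:
`tan(ψ/2) = (m/M)·tan(φ/2)` if and only if `(u, -v) ∈ E`. -/
theorem tan_half_angle_left_equality_iff
    {V : Type*} [AddCommGroup V] [Module ℝ V]
    (ip1 ip2 : V →ₗ[ℝ] V →ₗ[ℝ] ℝ)
    (symm1 : ∀ u v : V, ip1 u v = ip1 v u)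
    (symm2 : ∀ u v : V, ip2 u v = ip2 v u)
    (pos1 : ∀ v : V, v ≠ 0 → 0 < ip1 v v)
    (pos2 : ∀ v : V, v ≠ 0 → 0 < ip2 v v)
    (m M : ℝ) (hm0 : 0 < m)
    (hm : IsGLB {r : ℝ | ∃ v : V, v ≠ 0 ∧ r = Real.sqrt (ip2 v v) / Real.sqrt (ip1 v v)} m)
    (hM : IsLUB {r : ℝ | ∃ v : V, v ≠ 0 ∧ r = Real.sqrt (ip2 v v) / Real.sqrt (ip1 v v)} M)
    (u v : V) (huv : LinearIndependent ℝ ![u, v])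
    (φ ψ : ℝ) (hφ : φ ∈ Set.Icc 0 Real.pi) (hψ : ψ ∈ Set.Icc 0 Real.pi)
    (hcosφ : Real.cos φ = ip1 u v / (Real.sqrt (ip1 u u) * Real.sqrt (ip1 v v)))
    (hcosψ : Real.cos ψ = ip2 u v / (Real.sqrt (ip2 u u) * Real.sqrt (ip2 v v))) :
    Real.tan (ψ / 2) = m / M * Real.tan (φ / 2) ↔
      (u ≠ 0 ∧ (-v) ≠ 0 ∧
        ((Real.sqrt (ip1 u u))⁻¹ • u + (Real.sqrt (ip1 (-v) (-v)))⁻¹ • (-v) ∈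
          {w : V | Real.sqrt (ip2 w w) = m * Real.sqrt (ip1 w w)}) ∧
        ((Real.sqrt (ip1 u u))⁻¹ • u - (Real.sqrt (ip1 (-v) (-v)))⁻¹ • (-v) ∈
          {w : V | Real.sqrt (ip2 w w) = M * Real.sqrt (ip1 w w)})) := by
  have nonneg1 : ∀ w, 0 ≤ ip1 w w := fun w ↦ by
    rcases eq_or_ne w 0 with rfl | hw
    · simp
    · exact (pos1 w hw).le
  have nonneg2 : ∀ w, 0 ≤ ip2 w w := fun w ↦ by
    rcases eq_or_ne w 0 with rfl | hw
    · simp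
    · exact (pos2 w hw).le
  have hu : u ≠ 0 := huv.ne_zero 0
  have hv : v ≠ 0 := huv.ne_zero 1
  have hm_le : ∀ w, m ^ 2 * ip1 w w ≤ ip2 w w := fun w ↦ by
    rcases eq_or_ne w 0 with rfl | hw
    · simp
    · have h := hm.1 ⟨w, hw, rfl⟩
      rw [le_div_iff₀ (Real.sqrt_pos.mpr (pos1 w hw))] at h
      have h2 := pow_le_pow_left₀ (by positivity) h 2
      rwa [mul_pow, Real.sq_sqrt (nonneg1 w), Real.sq_sqrt (nonneg2 w)] at h2
  have le_hM : ∀ w, ip2 w w ≤ M ^ 2 * ip1 w w := fun w ↦ by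
    rcases eq_or_ne w 0 with rfl | hw
    · simp
    · have h := hM.1 ⟨w, hw, rfl⟩
      rw [div_le_iff₀ (Real.sqrt_pos.mpr (pos1 w hw))] at h
      have h2 := pow_le_pow_left₀ (by positivity) h 2
      rwa [mul_pow, Real.sq_sqrt (nonneg1 w), Real.sq_sqrt (nonneg2 w)] at h2
  have hM0 : 0 < M := hm0.trans_le ((hm.1 ⟨u, hu, rfl⟩).trans (hM.1 ⟨u, hu, rfl⟩))
  have hs : 0 < Real.sqrt (ip1 u u) := Real.sqrt_pos.mpr (pos1 u hu)
  have ht : 0 < Real.sqrt (ip1 v v) := Real.sqrt_pos.mpr (pos1 v hv)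
  have hs2 := Real.sq_sqrt (nonneg1 u)
  have ht2 := Real.sq_sqrt (nonneg1 v)
  have hneg : ip1 (-v) (-v) = ip1 v v := by simp
  rw [hneg]
  generalize Real.sqrt (ip1 u u) = s at *
  generalize Real.sqrt (ip1 v v) = t at *
  obtain ⟨a, ha⟩ : ∃ a, a = s⁻¹ • u := ⟨_, rfl⟩
  obtain ⟨b, hb⟩ : ∃ b, b = t⁻¹ • v := ⟨_, rfl⟩
  have hcomb : ∀ x y : ℝ, x • a + y • b = 0 → x = 0 ∧ y = 0 := fun x y h ↦ by
    rw [ha, hb, smul_smul, smul_smul] at h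
    have h2 := LinearIndependent.pair_iff.mp huv _ _ h
    simpa [hs.ne', ht.ne'] using h2
  have hua : u = s • a := by rw [ha, smul_smul, mul_inv_cancel₀ hs.ne', one_smul]
  have hvb : v = t • b := by rw [hb, smul_smul, mul_inv_cancel₀ ht.ne', one_smul]
  rw [smul_neg, ← ha, ← hb, ← sub_eq_add_neg, sub_neg_eq_add, Set.mem_ofPred_eq, Set.mem_ofPred_eq]
  clear ha hb
  subst hua hvb
  have hadd : a + b ≠ 0 := fun h ↦ by simpa using hcomb 1 1 (by simpa using h)
  have hsub : a - b ≠ 0 := fun h ↦ by simpa using hcomb 1 (-1) (by simpa [sub_eq_add_neg] using h)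
  have ha0 : a ≠ 0 := fun h ↦ hu (by simp [h])
  have hb0 : b ≠ 0 := fun h ↦ hv (by simp [h])
  have haa : ip1 a a = 1 := by
    simp only [map_smul, LinearMap.smul_apply, smul_eq_mul] at hs2
    have : s ^ 2 ≠ 0 := by positivity
    apply mul_left_cancel₀ this
    linarith
  have hbb : ip1 b b = 1 := by
    simp only [map_smul, LinearMap.smul_apply, smul_eq_mul] at ht2
    have : t ^ 2 ≠ 0 := by positivity
    apply mul_left_cancel₀ this
    linarith
  have hA : 0 < Real.sqrt (ip2 a a) := Real.sqrt_pos.mpr (pos2 a ha0)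
  have hB : 0 < Real.sqrt (ip2 b b) := Real.sqrt_pos.mpr (pos2 b hb0)
  have hA2 := Real.sq_sqrt (nonneg2 a)
  have hB2 := Real.sq_sqrt (nonneg2 b)
  have hsA : Real.sqrt (ip2 (s • a) (s • a)) = s * Real.sqrt (ip2 a a) := by
    rw [sqrt_eq_mul_sqrt_iff (nonneg2 _) (nonneg2 _) hs.le]
    simp only [map_smul, LinearMap.smul_apply, smul_eq_mul]
    ring
  have htB : Real.sqrt (ip2 (t • b) (t • b)) = t * Real.sqrt (ip2 b b) := by
    rw [sqrt_eq_mul_sqrt_iff (nonneg2 _) (nonneg2 _) ht.le]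
    simp only [map_smul, LinearMap.smul_apply, smul_eq_mul]
    ring
  rw [hsA, htB] at hcosψ
  generalize Real.sqrt (ip2 a a) = A at *
  generalize Real.sqrt (ip2 b b) = B at *
  have hk : Real.cos φ = ip1 a b := by
    rw [hcosφ]
    simp only [map_smul, LinearMap.smul_apply, smul_eq_mul]
    field_simp
  have hl : Real.cos ψ = ip2 a b / (A * B) := by
    rw [hcosψ]
    simp only [map_smul, LinearMap.smul_apply, smul_eq_mul]
    field_simp
  have hp1 : ip1 (a + b) (a + b) = 2 * (1 + Real.cos φ) := by
    simp only [map_add, LinearMap.add_apply, symm1 b a, haa, hbb, hk]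
    ring
  have hq1 : ip1 (a - b) (a - b) = 2 * (1 - Real.cos φ) := by
    simp only [map_sub, LinearMap.sub_apply, symm1 b a, haa, hbb, hk]
    ring
  have hp2 : ip2 (a + b) (a + b) = A ^ 2 + B ^ 2 + 2 * ip2 a b := by
    simp only [map_add, LinearMap.add_apply, symm2 b a, ← hA2, ← hB2]
    ring
  have hq2 : ip2 (a - b) (a - b) = A ^ 2 + B ^ 2 - 2 * ip2 a b := by
    simp only [map_sub, LinearMap.sub_apply, symm2 b a, ← hA2, ← hB2]
    ring
  have hp := pos1 _ hadd
  have hq := pos1 _ hsub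
  have hP := pos2 _ hadd
  have hperp := hm_le ((A ^ 2 + B ^ 2 + 2 * ip2 a b) • (a - b) - (A ^ 2 - B ^ 2) • (a + b))
  have hperp1 : ip1 ((A ^ 2 + B ^ 2 + 2 * ip2 a b) • (a - b) - (A ^ 2 - B ^ 2) • (a + b))
      ((A ^ 2 + B ^ 2 + 2 * ip2 a b) • (a - b) - (A ^ 2 - B ^ 2) • (a + b)) =
      (A ^ 2 + B ^ 2 + 2 * ip2 a b) ^ 2 * ip1 (a - b) (a - b) +
        (A ^ 2 - B ^ 2) ^ 2 * ip1 (a + b) (a + b) := by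
    simp only [map_sub, map_add, map_smul, LinearMap.sub_apply, LinearMap.add_apply,
      LinearMap.smul_apply, smul_eq_mul, symm1 b a, haa, hbb]
    ring
  have hperp2 : ip2 ((A ^ 2 + B ^ 2 + 2 * ip2 a b) • (a - b) - (A ^ 2 - B ^ 2) • (a + b))
      ((A ^ 2 + B ^ 2 + 2 * ip2 a b) • (a - b) - (A ^ 2 - B ^ 2) • (a + b)) =
      4 * (A * B - ip2 a b) * (A * B + ip2 a b) * (A ^ 2 + B ^ 2 + 2 * ip2 a b) := by
    simp only [map_sub, map_add, map_smul, LinearMap.sub_apply, LinearMap.add_apply,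
      LinearMap.smul_apply, smul_eq_mul, symm2 b a, ← hA2, ← hB2]
    ring
  rw [hperp1, hperp2] at hperp
  have hsum := le_hM (a + b)
  rw [sqrt_eq_mul_sqrt_iff (nonneg2 _) (nonneg1 _) hm0.le,
    sqrt_eq_mul_sqrt_iff (nonneg2 _) (nonneg1 _) hM0.le]
  rw [hp2] at hsum hP
  rw [hp2, hq2]
  have hAB : 0 < A * B := mul_pos hA hB
  have hc : 0 < A * B + ip2 a b := by
    have h1 : 0 < m ^ 2 * ((A ^ 2 + B ^ 2 + 2 * ip2 a b) ^ 2 * ip1 (a - b) (a - b) +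
        (A ^ 2 - B ^ 2) ^ 2 * ip1 (a + b) (a + b)) := by positivity
    have h2 := pos_of_mul_pos_left (h1.trans_le hperp) hP.le
    by_contra! h3
    nlinarith
  have hcφ : 0 < 1 + Real.cos φ := by linarith
  have hl2 : Real.cos ψ * (A * B) = ip2 a b := by rw [hl, div_mul_cancel₀ _ hAB.ne']
  have hcψ : 0 < 1 + Real.cos ψ := by
    refine pos_of_mul_pos_left (b := A * B) ?_ hAB.le
    linarith
  rw [tan_half_eq_mul_tan_half_iff (by positivity) hφ hψ hcφ hcψ]
  have key := half_angle_ratio_eq_iff hA hB hp hq hm0 hM0 hP hc hsum hperp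
  refine Iff.trans ?_ (key.trans ⟨fun h ↦ ⟨hu, neg_ne_zero.mpr hv, h⟩, fun h ↦ h.2.2⟩)
  rw [hp1, hq1, ← hl2]
  have hne : M ^ 2 * (2 * (A * B)) ≠ 0 := by positivity
  rw [← mul_left_inj' hne, div_pow]
  have e1 : m ^ 2 / M ^ 2 * (1 - Real.cos φ) * (1 + Real.cos ψ) * (M ^ 2 * (2 * (A * B))) =
      m ^ 2 * (2 * (1 - Real.cos φ)) * (A * B + Real.cos ψ * (A * B)) := by
    field_simp
  rw [e1]
  ring_nf
end

section
/- For linearly independent vectors u and v in V, let Φ, Ψ ∈ [0,π/2] be defined by cos Φ = |⟨u,v⟩₁|/(‖u‖₁‖v‖₁) and cos Ψ = |⟨u,v⟩₂|/(‖u‖₂‖v‖₂), and let α₁, α₂ ∈ {1,−1} satisfy |⟨u,v⟩₁| = α₁⟨u,v⟩₁ and |⟨u,v⟩₂| = α₂⟨u,v⟩₂. Then equality tan(Ψ/2) = (M/m)·tan(Φ/2) holds if and only if (α₁u, v) ∈ E and either α₁ = α₂ or ⟨u,v⟩₂ = 0. -/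
lemma tan_half_sq_eq_of_cos_eq {x k : ℝ} (hx : x ∈ Set.Icc 0 (Real.pi / 2))
    (hk : Real.cos x = k) :
    0 ≤ Real.tan (x / 2) ∧ Real.tan (x / 2) ^ 2 = (1 - k) / (1 + k) := by
  obtain ⟨h0, h1⟩ := hx
  have hpi := Real.pi_pos
  refine ⟨Real.tan_nonneg_of_nonneg_of_le_pi_div_two (by linarith) (by linarith), ?_⟩
  have hc : 0 < Real.cos (x / 2) := Real.cos_pos_of_mem_Ioo ⟨by linarith, by linarith⟩
  have hcos : Real.cos x = 2 * Real.cos (x / 2) ^ 2 - 1 := by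
    rw [← Real.cos_two_mul]; ring_nf
  rw [← hk, hcos, Real.tan_eq_sin_div_cos, div_pow, Real.sin_sq,
    div_eq_div_iff (by positivity)
    (by rw [add_sub_cancel]; positivity)]
  ring

/-- A null vector of a positive semidefinite symmetric form lies in its radical. -/
lemma apply_eq_zero_of_apply_self_eq_zero {V : Type*} [AddCommGroup V] [Module ℝ V]
    (B : V →ₗ[ℝ] V →ₗ[ℝ] ℝ) (symm : ∀ u v : V, B u v = B v u)
    (nonneg : ∀ v : V, 0 ≤ B v v) {w : V} (hw : B w w = 0) (z : V) : B w z = 0 := by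
  have h := LinearMap.BilinForm.apply_sq_le_of_symm B nonneg ⟨symm⟩ w z
  rw [hw, zero_mul] at h
  exact pow_eq_zero_iff two_ne_zero |>.1 (le_antisymm h (sq_nonneg _))

lemma sum_sq_eq_of_tan_sq_eq {p q c d m M : ℝ} (hp : 0 < p) (hq : 0 < q) (hc0 : 0 ≤ c)
    (hc1 : c < 1) (hm : 0 < m) (hM : 0 < M)
    (hadd : m ^ 2 * (2 + 2 * c) ≤ p ^ 2 + q ^ 2 + 2 * d)
    (hsub : p ^ 2 + q ^ 2 - 2 * d ≤ M ^ 2 * (2 - 2 * c))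
    (h : (1 - |d| / (p * q)) / (1 + |d| / (p * q)) = (M / m) ^ 2 * ((1 - c) / (1 + c))) :
    p ^ 2 + q ^ 2 + 2 * d = m ^ 2 * (2 + 2 * c) ∧
      p ^ 2 + q ^ 2 - 2 * d = M ^ 2 * (2 - 2 * c) ∧ 0 ≤ d := by
  have hs : 0 < p * q := mul_pos hp hq
  have hd := abs_nonneg d
  have hcross : (p * q - |d|) * (m ^ 2 * (2 + 2 * c)) = M ^ 2 * (2 - 2 * c) * (p * q + |d|) := by
    have h1 : 1 + c ≠ 0 := by linarith
    have h2 : 1 + |d| / (p * q) ≠ 0 := by positivity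
    have h3 : p * q + |d| ≠ 0 := by positivity
    field_simp at h
    linear_combination 2 * h
  have hlt : 0 < p * q - |d| := by
    have h1 : 0 < M ^ 2 * (2 - 2 * c) * (p * q + |d|) :=
      mul_pos (mul_pos (by positivity) (by linarith)) (by linarith)
    rw [← hcross] at h1
    exact pos_of_mul_pos_left h1 (by positivity)
  have h1 := mul_le_mul_of_nonneg_left hadd hlt.le
  have h2 := mul_le_mul_of_nonneg_right hsub (by linarith : 0 ≤ p * q + |d|)
  have hd0 : 0 ≤ d := by
    by_contra! hneg
    rw [abs_of_neg hneg] at *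
    nlinarith [mul_pos (neg_pos.2 hneg) hs, mul_pos (neg_pos.2 hneg) (pow_pos hp 2),
      mul_pos (neg_pos.2 hneg) (pow_pos hq 2)]
  rw [abs_of_nonneg hd0] at *
  have h3 : 0 ≤ d * (p - q) ^ 2 := by positivity
  refine ⟨le_antisymm ?_ hadd, le_antisymm hsub ?_, hd0⟩
  · refine le_of_mul_le_mul_left ?_ hlt
    nlinarith
  · refine le_of_mul_le_mul_right ?_ (by linarith : 0 < p * q + d)
    nlinarith

/-- The equality case for vectors that are normalised for the first inner product. -/
lemma tan_half_angle_eq_iff_of_unit {V : Type*} [AddCommGroup V] [Module ℝ V]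
    (ip1 ip2 : V →ₗ[ℝ] V →ₗ[ℝ] ℝ)
    (symm1 : ∀ u v : V, ip1 u v = ip1 v u) (symm2 : ∀ u v : V, ip2 u v = ip2 v u)
    (pos1 : ∀ v : V, v ≠ 0 → 0 < ip1 v v) (pos2 : ∀ v : V, v ≠ 0 → 0 < ip2 v v)
    {m M : ℝ} (hm : 0 < m) (hM : 0 < M)
    (hle : ∀ w, m ^ 2 * ip1 w w ≤ ip2 w w) (hge : ∀ w, ip2 w w ≤ M ^ 2 * ip1 w w)
    {a b : V} (ha : ip1 a a = 1) (hb : ip1 b b = 1) (hc : 0 ≤ ip1 a b) (hab : a - b ≠ 0)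
    {Φ Ψ : ℝ} (hΦ : Φ ∈ Set.Icc 0 (Real.pi / 2)) (hΨ : Ψ ∈ Set.Icc 0 (Real.pi / 2))
    (hcosΦ : Real.cos Φ = ip1 a b)
    (hcosΨ : Real.cos Ψ = |ip2 a b| / (Real.sqrt (ip2 a a) * Real.sqrt (ip2 b b))) :
    Real.tan (Ψ / 2) = M / m * Real.tan (Φ / 2) ↔
      (Real.sqrt (ip2 (a + b) (a + b)) = m * Real.sqrt (ip1 (a + b) (a + b)) ∧
        Real.sqrt (ip2 (a - b) (a - b)) = M * Real.sqrt (ip1 (a - b) (a - b))) ∧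
      0 ≤ ip2 a b := by
  obtain ⟨ht, ht2⟩ := tan_half_sq_eq_of_cos_eq hΦ hcosΦ
  obtain ⟨hT, hT2⟩ := tan_half_sq_eq_of_cos_eq hΨ hcosΨ
  have nonneg1 : ∀ w, 0 ≤ ip1 w w := fun w => by
    by_cases hw : w = 0
    · simp [hw]
    · exact (pos1 w hw).le
  have nonneg2 : ∀ w, 0 ≤ ip2 w w := fun w => by
    by_cases hw : w = 0
    · simp [hw]
    · exact (pos2 w hw).le
  have sqrt_eq_iff : ∀ {k : ℝ}, 0 < k → ∀ w, Real.sqrt (ip2 w w) = k * Real.sqrt (ip1 w w) ↔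
      ip2 w w = k ^ 2 * ip1 w w := fun {k} hk w => by
    rw [← sq_eq_sq₀ (Real.sqrt_nonneg _) (by positivity), mul_pow, Real.sq_sqrt (nonneg1 w),
      Real.sq_sqrt (nonneg2 w)]
  have ha0 : a ≠ 0 := by rintro rfl; simp at ha
  have hb0 : b ≠ 0 := by rintro rfl; simp at hb
  have hp : 0 < Real.sqrt (ip2 a a) := Real.sqrt_pos.2 (pos2 a ha0)
  have hq : 0 < Real.sqrt (ip2 b b) := Real.sqrt_pos.2 (pos2 b hb0)
  have hp2 := Real.sq_sqrt (nonneg2 a)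
  have hq2 := Real.sq_sqrt (nonneg2 b)
  have add1 : ip1 (a + b) (a + b) = 2 + 2 * ip1 a b := by
    simp only [map_add, LinearMap.add_apply, symm1 b a, ha, hb]; ring
  have sub1 : ip1 (a - b) (a - b) = 2 - 2 * ip1 a b := by
    simp only [map_sub, LinearMap.sub_apply, symm1 b a, ha, hb]; ring
  have add2 : ip2 (a + b) (a + b) = ip2 a a + ip2 b b + 2 * ip2 a b := by
    simp only [map_add, LinearMap.add_apply, symm2 b a]; ring
  have sub2 : ip2 (a - b) (a - b) = ip2 a a + ip2 b b - 2 * ip2 a b := by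
    simp only [map_sub, LinearMap.sub_apply, symm2 b a]; ring
  have hc1 : ip1 a b < 1 := by linarith [pos1 _ hab]
  rw [sqrt_eq_iff hm, sqrt_eq_iff hM, ← sq_eq_sq₀ hT (by positivity), mul_pow, hT2, ht2]
  constructor
  · intro h
    have h1 := hle (a + b)
    have h2 := hge (a - b)
    rw [add1, add2, ← hp2, ← hq2] at h1
    rw [sub1, sub2, ← hp2, ← hq2] at h2
    rw [add1, add2, sub1, sub2, ← hp2, ← hq2, and_assoc]
    exact sum_sq_eq_of_tan_sq_eq hp hq hc hc1 hm hM h1 h2 h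
  · rintro ⟨⟨h1, h2⟩, hd⟩
    have horth := apply_eq_zero_of_apply_self_eq_zero (ip2 - m ^ 2 • ip1)
      (fun x y => by simp [symm1 x y, symm2 x y]) (fun w => by simpa using hle w)
      (w := a + b) (sub_eq_zero.2 h1) (a - b)
    have hpq : ip2 b b = ip2 a a := by
      simp only [LinearMap.sub_apply, LinearMap.smul_apply, map_add, map_sub,
        LinearMap.add_apply, smul_eq_mul, symm1 b a, symm2 b a, ha, hb] at horth
      linarith
    rw [add1, add2, hpq] at h1
    rw [sub1, sub2, hpq] at h2
    have hP := pos2 a ha0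
    rw [hpq, Real.mul_self_sqrt hP.le, abs_of_nonneg hd]
    have h3 : 1 + ip1 a b ≠ 0 := by linarith
    have h4 : ip2 a a + ip2 a b ≠ 0 := by positivity
    have h5 : 1 + ip2 a b / ip2 a a ≠ 0 := by positivity
    field_simp
    linear_combination (-(ip2 a a - ip2 a b) * h1 + (ip2 a a + ip2 a b) * h2) / 2

/-- Theorem 2.6, equality case for the right-hand inequality:
`tan(Ψ/2) = (M/m)·tan(Φ/2)` iff `(α₁u, v) ∈ E` and (`α₁ = α₂` or `⟨u,v⟩₂ = 0`). -/
theorem tan_half_angle_lines_right_equality_iff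
    {V : Type*} [AddCommGroup V] [Module ℝ V]
    (ip1 ip2 : V →ₗ[ℝ] V →ₗ[ℝ] ℝ)
    (symm1 : ∀ u v : V, ip1 u v = ip1 v u)
    (symm2 : ∀ u v : V, ip2 u v = ip2 v u)
    (pos1 : ∀ v : V, v ≠ 0 → 0 < ip1 v v)
    (pos2 : ∀ v : V, v ≠ 0 → 0 < ip2 v v)
    (m M : ℝ) (hm0 : 0 < m)
    (hm : IsGLB {r : ℝ | ∃ v : V, v ≠ 0 ∧ r = Real.sqrt (ip2 v v) / Real.sqrt (ip1 v v)} m)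
    (hM : IsLUB {r : ℝ | ∃ v : V, v ≠ 0 ∧ r = Real.sqrt (ip2 v v) / Real.sqrt (ip1 v v)} M)
    (u v : V) (huv : LinearIndependent ℝ ![u, v])
    (Φ Ψ : ℝ) (hΦ : Φ ∈ Set.Icc 0 (Real.pi / 2)) (hΨ : Ψ ∈ Set.Icc 0 (Real.pi / 2))
    (hcosΦ : Real.cos Φ = |ip1 u v| / (Real.sqrt (ip1 u u) * Real.sqrt (ip1 v v)))
    (hcosΨ : Real.cos Ψ = |ip2 u v| / (Real.sqrt (ip2 u u) * Real.sqrt (ip2 v v)))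
    (α₁ α₂ : ℝ) (hα₁ : α₁ = 1 ∨ α₁ = -1) (hα₂ : α₂ = 1 ∨ α₂ = -1)
    (habs1 : |ip1 u v| = α₁ * ip1 u v) (habs2 : |ip2 u v| = α₂ * ip2 u v) :
    Real.tan (Ψ / 2) = M / m * Real.tan (Φ / 2) ↔
      ((α₁ • u ≠ 0 ∧ v ≠ 0 ∧
        ((Real.sqrt (ip1 (α₁ • u) (α₁ • u)))⁻¹ • (α₁ • u) + (Real.sqrt (ip1 v v))⁻¹ • v ∈
          {w : V | Real.sqrt (ip2 w w) = m * Real.sqrt (ip1 w w)}) ∧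
        ((Real.sqrt (ip1 (α₁ • u) (α₁ • u)))⁻¹ • (α₁ • u) - (Real.sqrt (ip1 v v))⁻¹ • v ∈
          {w : V | Real.sqrt (ip2 w w) = M * Real.sqrt (ip1 w w)})) ∧
       (α₁ = α₂ ∨ ip2 u v = 0)) := by
  have hu : u ≠ 0 := huv.ne_zero 0
  have hv : v ≠ 0 := huv.ne_zero 1
  have hx : 0 < Real.sqrt (ip1 u u) := Real.sqrt_pos.2 (pos1 u hu)
  have hy : 0 < Real.sqrt (ip1 v v) := Real.sqrt_pos.2 (pos1 v hv)
  have hx2 := Real.mul_self_sqrt (pos1 u hu).le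
  have hy2 := Real.mul_self_sqrt (pos1 v hv).le
  have hα : α₁ * α₁ = 1 := by rcases hα₁ with rfl | rfl <;> norm_num
  have hα0 : α₁ ≠ 0 := left_ne_zero_of_mul_eq_one hα
  have hle' : ∀ w, w ≠ 0 → m * Real.sqrt (ip1 w w) ≤ Real.sqrt (ip2 w w) := fun w hw =>
    (le_div_iff₀ (Real.sqrt_pos.2 (pos1 w hw))).1 (hm.1 ⟨w, hw, rfl⟩)
  have hge' : ∀ w, w ≠ 0 → Real.sqrt (ip2 w w) ≤ M * Real.sqrt (ip1 w w) := fun w hw =>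
    (div_le_iff₀ (Real.sqrt_pos.2 (pos1 w hw))).1 (hM.1 ⟨w, hw, rfl⟩)
  have hM0 : 0 < M := hm0.trans_le ((hm.1 ⟨u, hu, rfl⟩).trans (hM.1 ⟨u, hu, rfl⟩))
  have hle : ∀ w, m ^ 2 * ip1 w w ≤ ip2 w w := fun w => by
    by_cases hw : w = 0
    · simp [hw]
    · have h := pow_le_pow_left₀ (by positivity) (hle' w hw) 2
      rwa [mul_pow, Real.sq_sqrt (pos1 w hw).le, Real.sq_sqrt (pos2 w hw).le] at h
  have hge : ∀ w, ip2 w w ≤ M ^ 2 * ip1 w w := fun w => by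
    by_cases hw : w = 0
    · simp [hw]
    · have h := pow_le_pow_left₀ (by positivity) (hge' w hw) 2
      rwa [mul_pow, Real.sq_sqrt (pos1 w hw).le, Real.sq_sqrt (pos2 w hw).le] at h
  have hsmul : ip1 (α₁ • u) (α₁ • u) = ip1 u u := by
    simp only [map_smul, LinearMap.smul_apply, smul_eq_mul]
    rw [← mul_assoc, hα, one_mul]
  have hind : (Real.sqrt (ip1 u u))⁻¹ • (α₁ • u) - (Real.sqrt (ip1 v v))⁻¹ • v ≠ 0 := by
    intro h
    have h1 := (LinearIndependent.pair_iff.1 huv ((Real.sqrt (ip1 u u))⁻¹ * α₁)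
      (-(Real.sqrt (ip1 v v))⁻¹) (by rw [← h]; module)).2
    exact (inv_pos.2 hy).ne' (neg_eq_zero.1 h1)
  rw [hsmul]
  set x := Real.sqrt (ip1 u u)
  set y := Real.sqrt (ip1 v v)
  have hip : ∀ B : V →ₗ[ℝ] V →ₗ[ℝ] ℝ,
      B (x⁻¹ • (α₁ • u)) (y⁻¹ • v) = α₁ * B u v / (x * y) := fun B => by
    simp only [map_smul, LinearMap.smul_apply, smul_eq_mul]
    field_simp
  have hself : ∀ B : V →ₗ[ℝ] V →ₗ[ℝ] ℝ,
      B (x⁻¹ • (α₁ • u)) (x⁻¹ • (α₁ • u)) = B u u / x ^ 2 := fun B => by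
    simp only [map_smul, LinearMap.smul_apply, smul_eq_mul]
    field_simp
    linear_combination B u u * hα
  have hself' : ∀ B : V →ₗ[ℝ] V →ₗ[ℝ] ℝ,
      B (y⁻¹ • v) (y⁻¹ • v) = B v v / y ^ 2 := fun B => by
    simp only [map_smul, LinearMap.smul_apply, smul_eq_mul]
    field_simp
  have hcos2 : Real.cos Ψ = |ip2 (x⁻¹ • (α₁ • u)) (y⁻¹ • v)| /
      (Real.sqrt (ip2 (x⁻¹ • (α₁ • u)) (x⁻¹ • (α₁ • u))) *
        Real.sqrt (ip2 (y⁻¹ • v) (y⁻¹ • v))) := by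
    have hα' : |α₁| = 1 := by rcases hα₁ with rfl | rfl <;> norm_num
    have h1 := Real.sqrt_pos.2 (pos2 u hu)
    have h2 := Real.sqrt_pos.2 (pos2 v hv)
    rw [hcosΨ, hip, hself, hself', abs_div, abs_mul, hα', one_mul, abs_of_pos (mul_pos hx hy),
      Real.sqrt_div (pos2 u hu).le, Real.sqrt_div (pos2 v hv).le, Real.sqrt_sq hx.le,
      Real.sqrt_sq hy.le]
    field_simp
  have hsign : 0 ≤ ip2 (x⁻¹ • (α₁ • u)) (y⁻¹ • v) ↔ α₁ = α₂ ∨ ip2 u v = 0 := by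
    rw [hip, le_div_iff₀ (mul_pos hx hy), zero_mul]
    have h := abs_nonneg (ip2 u v)
    rw [habs2] at h
    constructor
    · intro h1
      rcases hα₁ with rfl | rfl <;> rcases hα₂ with rfl | rfl
      · exact Or.inl rfl
      · exact Or.inr (by linarith)
      · exact Or.inr (by linarith)
      · exact Or.inl rfl
    · rintro (rfl | h1)
      · exact h
      · simp [h1]
  rw [tan_half_angle_eq_iff_of_unit ip1 ip2 symm1 symm2 pos1 pos2 hm0 hM0 hle hge
    (by rw [hself, ← hx2, ← sq, div_self (pow_pos hx 2).ne'])
    (by rw [hself', ← hy2, ← sq, div_self (pow_pos hy 2).ne'])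
    (by rw [hip, ← habs1]; positivity) hind hΦ hΨ (by rw [hip, ← habs1, hcosΦ]) hcos2, hsign]
  simp only [Set.mem_ofPred_eq, ne_eq, smul_eq_zero, hα0, hu, hv, or_self, not_false_eq_true,
    true_and]
end

section
/- For linearly independent vectors u and v in V, −(M² − m²)/(M² + m²) ≤ |⟨u,v⟩₂|/(‖u‖₂‖v‖₂) − |⟨u,v⟩₁|/(‖u‖₁‖v‖₁) ≤ (M² − m²)/(M² + m²). -/
/-- If `K (1 + c) ≤ b (1 + y)` and `a (1 - y) ≤ K (1 - c)`, then `c` exceeds `|y|` by at most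
`(b - a) / (b + a)`. -/
lemma sub_abs_le_div_of_mul_le {a b c y K : ℝ} (ha : 0 < a) (hab : a ≤ b) (hc0 : 0 ≤ c)
    (hc1 : c ≤ 1) (hb : K * (1 + c) ≤ b * (1 + y)) (hk : a * (1 - y) ≤ K * (1 - c)) :
    c - |y| ≤ (b - a) / (b + a) := by
  have hprod : a * (1 - y) * (1 + c) ≤ b * (1 + y) * (1 - c) := by
    have h1 := mul_le_mul_of_nonneg_right hb (sub_nonneg.2 hc1)
    have h2 := mul_le_mul_of_nonneg_right hk (by linarith : 0 ≤ 1 + c)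
    linarith
  rw [le_div_iff₀ (by linarith)]
  rcases le_total 0 y with hy | hy
  · rw [abs_of_nonneg hy]
    nlinarith [mul_nonneg (mul_nonneg hy hc0) (sub_nonneg.2 hab)]
  · rw [abs_of_nonpos hy]
    have h3 : (b - a) * c ≤ b - a := mul_le_of_le_one_right (sub_nonneg.2 hab) hc1
    have h4 : y * (b + a - (b - a) * c) ≤ 0 :=
      mul_nonpos_of_nonpos_of_nonneg hy (by linarith)
    nlinarith [mul_nonpos_of_nonpos_of_nonneg hy (by linarith : 0 ≤ b + a)]

section TwoForms

variable {V : Type*} [AddCommGroup V] [Module ℝ V] {B₁ B₂ : V →ₗ[ℝ] V →ₗ[ℝ] ℝ} {a b : ℝ}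

lemma LinearMap.apply_smul_add_smul_self (B : V →ₗ[ℝ] V →ₗ[ℝ] ℝ)
    (hB : ∀ u v : V, B u v = B v u) (s t : ℝ) (u v : V) :
    B (s • u + t • v) (s • u + t • v) = s ^ 2 * B u u + 2 * (s * t) * B u v + t ^ 2 * B v v := by
  simp only [map_add, map_smul, LinearMap.add_apply, LinearMap.smul_apply, smul_eq_mul, hB v u]
  ring

lemma cos_sub_abs_cos_le (symm₁ : ∀ u v : V, B₁ u v = B₁ v u)
    (symm₂ : ∀ u v : V, B₂ u v = B₂ v u) (pos₁ : ∀ v : V, v ≠ 0 → 0 < B₁ v v)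
    (pos₂ : ∀ v : V, v ≠ 0 → 0 < B₂ v v) (ha : 0 < a) (hab : a ≤ b)
    (hlow : ∀ v, a * B₁ v v ≤ B₂ v v) (hup : ∀ v, B₂ v v ≤ b * B₁ v v)
    {u v : V} (hu : u ≠ 0) (hv : v ≠ 0) (huv : 0 ≤ B₂ u v) :
    B₂ u v / (√(B₂ u u) * √(B₂ v v)) - |B₁ u v| / (√(B₁ u u) * √(B₁ v v)) ≤
      (b - a) / (b + a) := by
  have hα := Real.sqrt_pos.2 (pos₂ u hu)
  have hβ := Real.sqrt_pos.2 (pos₂ v hv)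
  have hp := Real.sqrt_pos.2 (pos₁ u hu)
  have hr := Real.sqrt_pos.2 (pos₁ v hv)
  have hα2 := Real.sq_sqrt (pos₂ u hu).le
  have hβ2 := Real.sq_sqrt (pos₂ v hv).le
  have hp2 := Real.sq_sqrt (pos₁ u hu).le
  have hr2 := Real.sq_sqrt (pos₁ v hv).le
  set α := √(B₂ u u)
  set β := √(B₂ v v)
  set p := √(B₁ u u)
  set r := √(B₁ v v)
  have nonneg₁ (w : V) : 0 ≤ B₁ w w := by
    rcases eq_or_ne w 0 with rfl | hw
    · simp
    · exact (pos₁ w hw).le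
  have hplus := hup (β • u + α • v)
  have hminus := hlow (β • u + (-α) • v)
  have hminus₁ := nonneg₁ (β • u + (-α) • v)
  rw [B₁.apply_smul_add_smul_self symm₁, B₂.apply_smul_add_smul_self symm₂] at hplus hminus
  rw [B₁.apply_smul_add_smul_self symm₁] at hminus₁
  rw [← hα2, ← hβ2, ← hp2, ← hr2] at hplus hminus
  rw [← hp2, ← hr2] at hminus₁
  set D := B₂ u v
  set d := B₁ u v
  have hN : 0 < β ^ 2 * p ^ 2 + α ^ 2 * r ^ 2 := by positivity
  set N := β ^ 2 * p ^ 2 + α ^ 2 * r ^ 2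
  have hc1 : D / (α * β) ≤ 1 := by
    rw [div_le_one (by positivity)]
    have h1 : 0 ≤ 2 * (α * β) * (α * β - D) := by nlinarith [mul_nonneg ha.le hminus₁]
    have h2 := nonneg_of_mul_nonneg_right h1 (by positivity : 0 < 2 * (α * β))
    linarith
  have hy : |2 * (α * β) * d / N| ≤ |d| / (p * r) := by
    rw [abs_div, abs_mul, abs_of_pos hN, abs_of_pos (by positivity : 0 < 2 * (α * β)),
      div_le_div_iff₀ hN (by positivity)]
    nlinarith [mul_nonneg (abs_nonneg d) (sq_nonneg (β * p - α * r))]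
  have key := sub_abs_le_div_of_mul_le (c := D / (α * β)) (y := 2 * (α * β) * d / N)
    (K := 2 * (α * β) ^ 2 / N) ha hab (by positivity) hc1
    (by
      have e1 : 2 * (α * β) ^ 2 / N * (1 + D / (α * β)) =
          (2 * (α * β) ^ 2 + 2 * (α * β) * D) / N := by field_simp
      have e2 : b * (1 + 2 * (α * β) * d / N) = b * (N + 2 * (α * β) * d) / N := by field_simp
      rw [e1, e2]
      refine div_le_div_of_nonneg_right ?_ hN.le
      linarith)
    (by
      have e1 : 2 * (α * β) ^ 2 / N * (1 - D / (α * β)) =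
          (2 * (α * β) ^ 2 - 2 * (α * β) * D) / N := by field_simp
      have e2 : a * (1 - 2 * (α * β) * d / N) = a * (N - 2 * (α * β) * d) / N := by field_simp
      rw [e1, e2]
      refine div_le_div_of_nonneg_right ?_ hN.le
      linarith)
  linarith

lemma abs_cos_sub_abs_cos_le (symm₁ : ∀ u v : V, B₁ u v = B₁ v u)
    (symm₂ : ∀ u v : V, B₂ u v = B₂ v u) (pos₁ : ∀ v : V, v ≠ 0 → 0 < B₁ v v)
    (pos₂ : ∀ v : V, v ≠ 0 → 0 < B₂ v v) (ha : 0 < a) (hab : a ≤ b)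
    (hlow : ∀ v, a * B₁ v v ≤ B₂ v v) (hup : ∀ v, B₂ v v ≤ b * B₁ v v)
    {u v : V} (hu : u ≠ 0) (hv : v ≠ 0) :
    |B₂ u v| / (√(B₂ u u) * √(B₂ v v)) - |B₁ u v| / (√(B₁ u u) * √(B₁ v v)) ≤
      (b - a) / (b + a) := by
  rcases le_total 0 (B₂ u v) with h | h
  · rw [abs_of_nonneg h]
    exact cos_sub_abs_cos_le symm₁ symm₂ pos₁ pos₂ ha hab hlow hup hu hv h
  · rw [abs_of_nonpos h]
    simpa using cos_sub_abs_cos_le symm₁ symm₂ pos₁ pos₂ ha hab hlow hup hu (neg_ne_zero.2 hv)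
      (by simpa using h)

end TwoForms


/-- Theorem 2.8, inequality (2.12): for independent vectors `u, v`,
`−(M²−m²)/(M²+m²) ≤ |⟨u,v⟩₂|/(‖u‖₂‖v‖₂) − |⟨u,v⟩₁|/(‖u‖₁‖v‖₁) ≤ (M²−m²)/(M²+m²)`. -/
theorem abs_cos_difference_bounds
    {V : Type*} [AddCommGroup V] [Module ℝ V]
    (ip1 ip2 : V →ₗ[ℝ] V →ₗ[ℝ] ℝ)
    (symm1 : ∀ u v : V, ip1 u v = ip1 v u)
    (symm2 : ∀ u v : V, ip2 u v = ip2 v u)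
    (pos1 : ∀ v : V, v ≠ 0 → 0 < ip1 v v)
    (pos2 : ∀ v : V, v ≠ 0 → 0 < ip2 v v)
    (m M : ℝ) (hm0 : 0 < m)
    (hm : IsGLB {r : ℝ | ∃ v : V, v ≠ 0 ∧ r = Real.sqrt (ip2 v v) / Real.sqrt (ip1 v v)} m)
    (hM : IsLUB {r : ℝ | ∃ v : V, v ≠ 0 ∧ r = Real.sqrt (ip2 v v) / Real.sqrt (ip1 v v)} M)
    (u v : V) (huv : LinearIndependent ℝ ![u, v]) :
    -((M ^ 2 - m ^ 2) / (M ^ 2 + m ^ 2)) ≤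
        |ip2 u v| / (Real.sqrt (ip2 u u) * Real.sqrt (ip2 v v)) -
          |ip1 u v| / (Real.sqrt (ip1 u u) * Real.sqrt (ip1 v v)) ∧
      |ip2 u v| / (Real.sqrt (ip2 u u) * Real.sqrt (ip2 v v)) -
          |ip1 u v| / (Real.sqrt (ip1 u u) * Real.sqrt (ip1 v v)) ≤
        (M ^ 2 - m ^ 2) / (M ^ 2 + m ^ 2) := by
  have hu : u ≠ 0 := by simpa using huv.ne_zero 0
  have hv : v ≠ 0 := by simpa using huv.ne_zero 1
  have hmM : m ≤ M := (hm.1 ⟨u, hu, rfl⟩).trans (hM.1 ⟨u, hu, rfl⟩)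
  have hM0 : 0 < M := hm0.trans_le hmM
  have hsq : m ^ 2 ≤ M ^ 2 := pow_le_pow_left₀ hm0.le hmM 2
  have hlow (w : V) : m ^ 2 * ip1 w w ≤ ip2 w w := by
    rcases eq_or_ne w 0 with rfl | hw
    · simp
    · have h := hm.1 ⟨w, hw, rfl⟩
      rw [← Real.sqrt_div (pos2 w hw).le, Real.le_sqrt' hm0, le_div_iff₀ (pos1 w hw)] at h
      exact h
  have hup (w : V) : ip2 w w ≤ M ^ 2 * ip1 w w := by
    rcases eq_or_ne w 0 with rfl | hw
    · simp
    · have h := hM.1 ⟨w, hw, rfl⟩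
      rw [← Real.sqrt_div (pos2 w hw).le, Real.sqrt_le_left hM0.le, div_le_iff₀ (pos1 w hw)] at h
      exact h
  refine ⟨?_, abs_cos_sub_abs_cos_le symm1 symm2 pos1 pos2 (by positivity) hsq hlow hup hu hv⟩
  have h := abs_cos_sub_abs_cos_le symm2 symm1 pos2 pos1 (a := (M ^ 2)⁻¹) (b := (m ^ 2)⁻¹)
    (by positivity) (inv_anti₀ (by positivity) hsq)
    (fun w => (inv_mul_le_iff₀ (by positivity)).2 (hup w))
    (fun w => (le_inv_mul_iff₀ (by positivity)).2 (hlow w)) hu hv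
  have e : ((m ^ 2)⁻¹ - (M ^ 2)⁻¹) / ((m ^ 2)⁻¹ + (M ^ 2)⁻¹) =
      (M ^ 2 - m ^ 2) / (M ^ 2 + m ^ 2) := by field_simp
  linarith
end
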